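/- Let T be a real-linear subspace of ℂⁿ whose ℂ-linear span is all of ℂⁿ, and let V be a complex-linear subspace of ℂⁿ. Then dim_ℝ T − dim_ℝ (V ∩ T) ≥ n − dim_ℂ V, where V ∩ T is regarded as a real vector space. -/

import Mathlib

theorem real_codim_ge_complex_codim
    (n : ℕ) (T : Submodule ℝ (Fin n → ℂ)) (V : Submodule ℂ (Fin n → ℂ))
    (hT : Submodule.span ℂ (T : Set (Fin n → ℂ)) = ⊤) :
    (n : ℤ) - Module.finrank ℂ V ≤
      (Module.finrank ℝ T : ℤ) - Module.finrank ℝ (V.restrictScalars ℝ ⊓ T : Submodule ℝ (Fin n → ℂ)) := by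
  let f : T →ₗ[ℝ] ((Fin n → ℂ) ⧸ V) := (V.mkQ.restrictScalars ℝ).comp T.subtype
  have h1 := LinearMap.finrank_range_add_finrank_ker f
  have hk : LinearMap.ker f = Submodule.comap T.subtype (V.restrictScalars ℝ) := by
    ext x
    simp [f]
  have h2 : Module.finrank ℝ (LinearMap.ker f)
      = Module.finrank ℝ (V.restrictScalars ℝ ⊓ T : Submodule ℝ (Fin n → ℂ)) := by
    rw [hk, inf_comm, ← Submodule.map_comap_subtype]
    exact (LinearEquiv.finrank_eq (Submodule.equivMapOfInjective T.subtype
      T.injective_subtype _))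
  have h3 := Submodule.finrank_quotient_add_finrank V
  rw [Module.finrank_fin_fun] at h3
  have h4 : Module.finrank ℂ ((Fin n → ℂ) ⧸ V) ≤ Module.finrank ℝ (LinearMap.range f) := by
    let b := Module.finBasis ℝ (LinearMap.range f)
    have hs : Submodule.span ℂ (Set.range (fun i => (b i : (Fin n → ℂ) ⧸ V))) = ⊤ := by
      set S := Submodule.span ℂ (Set.range (fun i => (b i : (Fin n → ℂ) ⧸ V)))
      have hR : ∀ y : LinearMap.range f, (y : (Fin n → ℂ) ⧸ V) ∈ S := by
        intro y
        rw [← b.sum_repr y, Submodule.coe_sum]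
        refine Submodule.sum_mem _ fun i _ => ?_
        rw [Submodule.coe_smul]
        exact (S.restrictScalars ℝ).smul_mem _ (Submodule.subset_span ⟨i, rfl⟩)
      have hc : S.comap V.mkQ = ⊤ := by
        rw [eq_top_iff, ← hT, Submodule.span_le]
        intro x hx
        exact hR ⟨f ⟨x, hx⟩, ⟨_, rfl⟩⟩
      rw [eq_top_iff]
      intro y _
      obtain ⟨x, rfl⟩ := V.mkQ_surjective y
      have : x ∈ S.comap V.mkQ := hc ▸ Submodule.mem_top
      exact this
    have := finrank_range_le_card (R := ℂ) (fun i => (b i : (Fin n → ℂ) ⧸ V))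
    rw [Set.finrank, hs, finrank_top, Fintype.card_fin] at this
    exact this
  omega
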